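/- Let X be a set, (𝒴, ℓ) a metric space, and ℋ a class of functions X → 𝒴. Let S ⊆ ℋ be a nonempty finite set with τ(S) < ∞, let f0 ∈ S, and fix x ∈ X. For ε ≥ 0 define A_ε = { y ∈ 𝒴 : S_y ≠ ∅ and τ(S_y) ≥ τ(S) − ε }, where S_y = { f ∈ S : f(x) = y }, and let ε* = min{ ε ≥ 0 : A_ε ≠ ∅ } (this minimum exists since S is finite). Then for every y ∈ A_{ε*}, one has τ(S_{f0(x)}) ≤ τ(S) − ℓ(y, f0(x)). -/

import Mathlib

/-- An `(X, 𝒴)`-tree: a finite rooted binary tree in which every internal node has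
exactly two children and is labeled by a triple `(x, y₁, y₂)`. -/
inductive LTree (X Y : Type*) where
  | leaf : LTree X Y
  | node : X → Y → Y → LTree X Y → LTree X Y → LTree X Y

/-- The cost of an `(X, 𝒴)`-tree: the minimum over leaves of the sum of `ℓ(y₁, y₂)`
over the internal nodes on the root-to-leaf path (a single leaf has cost `0`). -/
noncomputable def LTree.cost {X Y : Type*} [MetricSpace Y] : LTree X Y → ℝ
  | .leaf => 0
  | .node _ y1 y2 l r => dist y1 y2 + min l.cost r.cost

/-- `LTree.Sat H t`: the tree `t` is `H`-satisfiable. -/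
def LTree.Sat {X Y : Type*} : Set (X → Y) → LTree X Y → Prop
  | H, .leaf => H.Nonempty
  | H, .node x y1 y2 l r => LTree.Sat {f ∈ H | f x = y1} l ∧ LTree.Sat {f ∈ H | f x = y2} r

/-- The tree dimension `τ(H)`: the supremum of the costs of `H`-satisfiable trees. -/
noncomputable def treeDim {X Y : Type*} [MetricSpace Y] (H : Set (X → Y)) : ℝ :=
  sSup (LTree.cost '' {t : LTree X Y | LTree.Sat H t})

theorem LTree.Sat.mono {X Y : Type*} {t : LTree X Y} {A B : Set (X → Y)} (hAB : A ⊆ B)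
    (h : LTree.Sat A t) : LTree.Sat B t := by
  induction t generalizing A B with
  | leaf => exact Set.Nonempty.mono hAB h
  | node x y1 y2 l r ihl ihr =>
    exact ⟨ihl (fun _ hf => ⟨hAB hf.1, hf.2⟩) h.1, ihr (fun _ hf => ⟨hAB hf.1, hf.2⟩) h.2⟩

theorem treeDim_mono {X Y : Type*} [MetricSpace Y] {A B : Set (X → Y)} (hA : A.Nonempty)
    (hAB : A ⊆ B) (hB : BddAbove (LTree.cost '' {t : LTree X Y | LTree.Sat B t})) :
    treeDim A ≤ treeDim B :=
  csSup_le_csSup hB ⟨_, .leaf, hA, rfl⟩ (Set.image_mono fun _ ht => LTree.Sat.mono hAB ht)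

theorem exists_sat_lt_cost {X Y : Type*} [MetricSpace Y] {A : Set (X → Y)} (hA : A.Nonempty)
    {c : ℝ} (hc : c < treeDim A) : ∃ t : LTree X Y, LTree.Sat A t ∧ c < t.cost := by
  obtain ⟨_, ⟨t, ht, rfl⟩, hlt⟩ := exists_lt_of_lt_csSup
    (s := LTree.cost '' {t : LTree X Y | LTree.Sat A t}) ⟨_, .leaf, hA, rfl⟩ hc
  exact ⟨t, ht, hlt⟩

/-- Splitting `S` at `x` into two nonempty fibres: the smaller of their tree dimensions, plus the
distance between the two values, is at most the tree dimension of `S`. -/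
theorem dist_add_min_treeDim_le {X Y : Type*} [MetricSpace Y] {S : Set (X → Y)}
    (hS : BddAbove (LTree.cost '' {t : LTree X Y | LTree.Sat S t})) {x : X} {y z : Y}
    (hy : {f ∈ S | f x = y}.Nonempty) (hz : {f ∈ S | f x = z}.Nonempty) :
    dist y z + min (treeDim {f ∈ S | f x = y}) (treeDim {f ∈ S | f x = z}) ≤ treeDim S := by
  rw [← le_sub_iff_add_le']
  refine le_of_forall_lt fun c hc => ?_
  obtain ⟨l, hl, hcl⟩ := exists_sat_lt_cost hy (hc.trans_le (min_le_left _ _))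
  obtain ⟨r, hr, hcr⟩ := exists_sat_lt_cost hz (hc.trans_le (min_le_right _ _))
  have hcost : dist y z + min l.cost r.cost ≤ treeDim S :=
    le_csSup hS ⟨.node x y z l r, ⟨hl, hr⟩, rfl⟩
  have hmin : c < min l.cost r.cost := lt_min hcl hcr
  linarith

theorem stmt18 {X Y : Type*} [MetricSpace Y] (H : Set (X → Y)) (S : Set (X → Y))
    (hSH : S ⊆ H) (hSne : S.Nonempty) (hSfin : S.Finite)
    (hfin : BddAbove (LTree.cost '' {t : LTree X Y | LTree.Sat S t}))
    (f0 : X → Y) (hf0 : f0 ∈ S) (x : X)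
    (εstar : ℝ)
    (hstar : IsLeast {ε : ℝ | 0 ≤ ε ∧
        ∃ y : Y, {f ∈ S | f x = y}.Nonempty ∧ treeDim S - ε ≤ treeDim {f ∈ S | f x = y}}
      εstar)
    (y : Y)
    (hy : {f ∈ S | f x = y}.Nonempty ∧ treeDim S - εstar ≤ treeDim {f ∈ S | f x = y}) :
    treeDim {f ∈ S | f x = f0 x} ≤ treeDim S - dist y (f0 x) := by
  have hne : {f ∈ S | f x = f0 x}.Nonempty := ⟨f0, hf0, rfl⟩
  have hmono := treeDim_mono hne (Set.sep_subset S _) hfin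
  have hmin := hstar.2 ⟨sub_nonneg.2 hmono, f0 x, hne, (sub_sub_cancel _ _).le⟩
  have hle : treeDim {f ∈ S | f x = f0 x} ≤ treeDim {f ∈ S | f x = y} := by linarith [hy.2]
  have h := dist_add_min_treeDim_le hfin hy.1 hne
  rw [min_eq_right hle] at h
  linarith
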